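/- Let α, β ≥ 0, let a > 0, and let (q_n)_{n≥1} be a sequence with 0 < q_n < 1 and (1-q_n^n)·a < 1 for all n, such that st-lim q_n = 1 and st-lim q_n^n = b for some b < 1. Then st-lim_n sup_{x∈[0,a], t∈[0,a]} |T_{n,t}^{α,β}(e₂;q_n;x) − (x+t)²| = 0, where e₂(s) = s². -/

import Mathlib

open Filter

/-- The `q`-integer `[n]_q = (1 - q^n)/(1 - q)`. -/
noncomputable def qInt (q : ℝ) (n : ℕ) : ℝ := (1 - q ^ n) / (1 - q)

/-- The `q`-factorial `[n]_q! = [1]_q [2]_q ⋯ [n]_q`, with `[0]_q! = 1`. -/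
noncomputable def qFact (q : ℝ) (n : ℕ) : ℝ := ∏ i ∈ Finset.range n, qInt q (i + 1)

/-- The `q`-exponential `e_q^x = ∑ x^n/[n]_q!`. -/
noncomputable def qExp (q x : ℝ) : ℝ := ∑' n : ℕ, x ^ n / qFact q n

/-- The `q`-exponential `E_q^x = ∑ q^{n(n-1)/2} x^n/[n]_q!`. -/
noncomputable def qExpE (q x : ℝ) : ℝ := ∑' n : ℕ, q ^ (n * (n - 1) / 2) * x ^ n / qFact q n

/-- The power series `A(u) = ∑ c_k u^k`. -/
noncomputable def APow (c : ℕ → ℝ) (u : ℝ) : ℝ := ∑' k : ℕ, c k * u ^ k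

/-- The `q`-Appell polynomial `P_k(q;y) = [k]_q! ∑_{j=0}^k c_j y^{k-j}/[k-j]_q!`. -/
noncomputable def qAppell (c : ℕ → ℝ) (q y : ℝ) (k : ℕ) : ℝ :=
  qFact q k * ∑ j ∈ Finset.range (k + 1), c j * y ^ (k - j) / qFact q (k - j)

/-- `D_q A(1) = (A(1) - A(q))/(1-q)`. -/
noncomputable def DqA1 (c : ℕ → ℝ) (q : ℝ) : ℝ := (APow c 1 - APow c q) / (1 - q)

/-- `D_q A(q) = (A(q) - A(q²))/((1-q) q)`. -/
noncomputable def DqAq (c : ℕ → ℝ) (q : ℝ) : ℝ := (APow c q - APow c (q ^ 2)) / ((1 - q) * q)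

/-- `D_q² A(1) = (D_q A(1) - D_q A(q))/(1-q)`. -/
noncomputable def Dq2A1 (c : ℕ → ℝ) (q : ℝ) : ℝ := (DqA1 c q - DqAq c q) / (1 - q)

/-- The Stancu-type `q`-Favard–Szász operator `T_{n,t}^{α,β}(f;q;x)`. -/
noncomputable def Tq (c : ℕ → ℝ) (q : ℝ) (n : ℕ) (t α β : ℝ) (f : ℝ → ℝ) (x : ℝ) : ℝ :=
  qExpE q (-(qInt q n * t)) / APow c 1 *
    ∑' k : ℕ, qAppell c q (qInt q n * t) k / qFact q k *
      f (x + (qInt q k + α) / (qInt q n + β))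

/-- Statistical convergence of a real sequence to `l`. -/
def StatLim (x : ℕ → ℝ) (l : ℝ) : Prop :=
  ∀ ε > 0, Tendsto
    (fun n : ℕ => (((Finset.Icc 1 n).filter fun k => ε ≤ |x k - l|).card : ℝ) / n)
    atTop (nhds 0)

/-- Modulus of continuity of `f` on `[0,∞)`. -/
noncomputable def modCont (f : ℝ → ℝ) (δ : ℝ) : ℝ :=
  sSup {r : ℝ | ∃ u v : ℝ, 0 ≤ u ∧ 0 ≤ v ∧ |u - v| ≤ δ ∧ r = |f u - f v|}

/-- Second-order modulus of smoothness of `f` on `[0,∞)`. -/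
noncomputable def mod2 (f : ℝ → ℝ) (δ : ℝ) : ℝ :=
  sSup {r : ℝ | ∃ h x : ℝ, 0 < h ∧ h ≤ δ ∧ 0 ≤ x ∧
    r = |f (x + 2 * h) - 2 * f (x + h) + f x|}

lemma aux_qInt_pos {q : ℝ} (h0 : 0 < q) (h1 : q < 1) (n : ℕ) : 0 < qInt q (n + 1) := by
  unfold qInt
  have := pow_lt_one₀ h0.le h1 (Nat.succ_ne_zero n)
  exact div_pos (by simpa using this) (by linarith)

lemma aux_qFact_pos {q : ℝ} (h0 : 0 < q) (h1 : q < 1) (n : ℕ) : 0 < qFact q n :=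
  Finset.prod_pos fun i _ => aux_qInt_pos h0 h1 i

lemma aux_qFact_succ (q : ℝ) (n : ℕ) : qFact q (n + 1) = qFact q n * qInt q (n + 1) := by
  simp [qFact, Finset.prod_range_succ]

lemma aux_qInt_mul {q : ℝ} (h1 : q < 1) (n : ℕ) : (1 - q) * qInt q n = 1 - q ^ n := by
  unfold qInt
  have : 1 - q ≠ 0 := by linarith
  field_simp

lemma aux_step {q : ℝ} (h0 : 0 < q) (h1 : q < 1) (n : ℕ) :
    (1 - q ^ (n + 1)) / qFact q (n + 1) = (1 - q) / qFact q n := by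
  rw [aux_qFact_succ, ← aux_qInt_mul h1]
  have := (aux_qInt_pos h0 h1 n).ne'
  have := (aux_qFact_pos h0 h1 n).ne'
  field_simp

lemma aux_summ {q y : ℝ} (h0 : 0 < q) (h1 : q < 1) (hy : 0 ≤ y) (hy1 : (1 - q) * y < 1) :
    Summable fun n : ℕ => y ^ n / qFact q n := by
  obtain ⟨r, hr, hr1⟩ := exists_between hy1
  refine summable_of_ratio_norm_eventually_le (r := r) hr1 ?_
  have ht : Tendsto (fun n : ℕ => r * (1 - q ^ (n + 1))) atTop (nhds (r * (1 - 0))) :=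
    ((tendsto_const_nhds.sub ((tendsto_add_atTop_iff_nat 1).2
      (tendsto_pow_atTop_nhds_zero_of_lt_one h0.le h1))).const_mul r)
  have := ht.eventually_const_lt (u := (1 - q) * y) (by simpa using hr)
  filter_upwards [this] with n hn
  have hF := aux_qFact_pos h0 h1 n
  have hF1 := aux_qFact_pos h0 h1 (n + 1)
  have hI := aux_qInt_pos h0 h1 n
  rw [Real.norm_of_nonneg (by positivity), Real.norm_of_nonneg (by positivity), aux_qFact_succ]
  have h2 : y ≤ r * qInt q (n + 1) := by
    rw [← aux_qInt_mul h1] at hn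
    nlinarith
  rw [pow_succ, mul_div_mul_comm, mul_comm]
  gcongr
  rw [div_le_iff₀ hI]; exact h2

lemma aux_exp_q {q y : ℝ} (h0 : 0 < q) (h1 : q < 1) (hy : 0 ≤ y) (hy1 : (1 - q) * y < 1) :
    qExp q (q * y) = (1 - (1 - q) * y) * qExp q y := by
  have hs := aux_summ h0 h1 hy hy1
  have hs2 := aux_summ (y := q * y) h0 h1 (by positivity) (by nlinarith [mul_nonneg (sub_nonneg.2 h1.le) hy])
  have : qExp q y - qExp q (q * y) = (1 - q) * y * qExp q y := by
    unfold qExp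
    rw [← hs.tsum_sub hs2, (hs.sub hs2).tsum_eq_zero_add, ← tsum_mul_left]
    simp only [pow_zero, sub_self, zero_add]
    congr 1; ext n
    have := aux_step h0 h1 n
    calc _ = y ^ (n + 1) * ((1 - q ^ (n + 1)) / qFact q (n + 1)) := by ring
      _ = _ := by rw [this]; ring
  linarith

lemma aux_tri (n : ℕ) : (n + 1) * (n + 1 - 1) / 2 = n * (n - 1) / 2 + n := by
  have := Finset.sum_range_id (n + 1)
  have h := Finset.sum_range_id n
  rw [Finset.sum_range_succ] at this
  omega

lemma aux_summE {q y x : ℝ} (h0 : 0 < q) (h1 : q < 1) (hy1 : (1 - q) * y < 1)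
    (hx : |x| ≤ y) : Summable fun n : ℕ => q ^ (n * (n - 1) / 2) * x ^ n / qFact q n := by
  have hy := (abs_nonneg x).trans hx
  refine Summable.of_norm_bounded (aux_summ h0 h1 hy hy1) fun n => ?_
  have hF := aux_qFact_pos h0 h1 n
  rw [norm_div, norm_mul, norm_pow, norm_pow, Real.norm_of_nonneg hF.le, Real.norm_of_nonneg h0.le]
  gcongr
  calc _ ≤ 1 * y ^ n := by
        gcongr
        · exact pow_le_one₀ h0.le h1.le
        · exact hx
    _ = _ := one_mul _

lemma aux_expE_q {q y : ℝ} (h0 : 0 < q) (h1 : q < 1) (hy : 0 ≤ y) (hy1 : (1 - q) * y < 1) :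
    qExpE q (-y) = (1 - (1 - q) * y) * qExpE q (-(q * y)) := by
  have hs := aux_summE (x := -y) h0 h1 hy1 (by rw [abs_neg, abs_of_nonneg hy])
  have hs2 := aux_summE (x := -(q * y)) h0 h1 hy1
    (by rw [abs_neg, abs_of_nonneg (by positivity)]; nlinarith)
  have : qExpE q (-y) - qExpE q (-(q * y)) = -(1 - q) * y * qExpE q (-(q * y)) := by
    unfold qExpE
    rw [← hs.tsum_sub hs2, (hs.sub hs2).tsum_eq_zero_add, ← tsum_mul_left]
    simp only [pow_zero, sub_self, zero_add]
    congr 1; ext n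
    have := aux_step h0 h1 n
    rw [aux_tri]
    calc _ = q ^ (n * (n - 1) / 2) * q ^ n * (-y) ^ (n + 1)
            * ((1 - q ^ (n + 1)) / qFact q (n + 1)) := by
            rw [show -(q * y) = q * -y by ring, mul_pow, pow_add q _ n]; ring
      _ = _ := by
        rw [this, show -(q * y) = q * -y by ring, mul_pow]; ring
  linarith

lemma aux_cont {q y : ℝ} (h0 : 0 < q) (h1 : q < 1) (hy : 0 ≤ y) (hy1 : (1 - q) * y < 1) :
    ContinuousOn (fun x => qExpE q (-x) * qExp q x) (Set.Icc 0 y) := by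
  have hs := aux_summ h0 h1 hy hy1
  apply ContinuousOn.mul
  · unfold qExpE
    refine continuousOn_tsum (u := fun n : ℕ => y ^ n / qFact q n) (fun i => by fun_prop) hs ?_
    intro n x hx
    have hF := aux_qFact_pos h0 h1 n
    rw [norm_div, norm_mul, norm_pow, norm_pow, Real.norm_of_nonneg hF.le,
      Real.norm_of_nonneg h0.le, norm_neg, Real.norm_of_nonneg hx.1]
    gcongr
    calc _ ≤ 1 * y ^ n := by
          gcongr
          · exact pow_nonneg hx.1 _
          · exact pow_le_one₀ h0.le h1.le
          · exact hx.1
          · exact hx.2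
      _ = _ := one_mul _
  · unfold qExp
    refine continuousOn_tsum (u := fun n : ℕ => y ^ n / qFact q n) (fun i => by fun_prop) hs ?_
    intro n x hx
    have hF := aux_qFact_pos h0 h1 n
    rw [norm_div, norm_pow, Real.norm_of_nonneg hF.le, Real.norm_of_nonneg hx.1]
    have := hx.1
    gcongr
    exact hx.2

lemma aux_inv {q y : ℝ} (h0 : 0 < q) (h1 : q < 1) (hy : 0 ≤ y) (hy1 : (1 - q) * y < 1) :
    qExpE q (-y) * qExp q y = 1 := by
  have hq : ∀ m : ℕ, q ^ m * y ∈ Set.Icc 0 y := fun m =>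
    ⟨by positivity, mul_le_of_le_one_left hy (pow_le_one₀ h0.le h1.le)⟩
  have key : ∀ m : ℕ, qExpE q (-(q ^ m * y)) * qExp q (q ^ m * y) = qExpE q (-y) * qExp q y := by
    intro m
    induction m with
    | zero => simp
    | succ m ih =>
      have h2 : (1 - q) * (q ^ m * y) < 1 :=
        lt_of_le_of_lt (mul_le_mul_of_nonneg_left (hq m).2 (by linarith)) hy1
      rw [← ih, aux_expE_q h0 h1 (hq m).1 h2, show q ^ (m + 1) * y = q * (q ^ m * y) by ring,
        aux_exp_q h0 h1 (hq m).1 h2]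
      ring
  have hz : Tendsto (fun m : ℕ => q ^ m * y) atTop (nhdsWithin 0 (Set.Icc 0 y)) := by
    rw [tendsto_nhdsWithin_iff]
    refine ⟨?_, Eventually.of_forall hq⟩
    simpa using (tendsto_pow_atTop_nhds_zero_of_lt_one h0.le h1).mul_const y
  have hc := (aux_cont h0 h1 hy hy1 0 ⟨le_rfl, hy⟩).tendsto.comp hz
  have hc2 : Tendsto (fun _ : ℕ => qExpE q (-y) * qExp q y) atTop
      (nhds (qExpE q (-0) * qExp q 0)) := by
    refine hc.congr fun m => ?_
    exact key m
  rw [tendsto_nhds_unique tendsto_const_nhds hc2]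
  have e1 : qExpE q (-0) = 1 := by
    unfold qExpE
    rw [tsum_eq_single 0]
    · simp [qFact]
    · intro n hn; simp [hn]
  have e2 : qExp q 0 = 1 := by
    unfold qExp
    rw [tsum_eq_single 0]
    · simp [qFact]
    · intro n hn; simp [hn]
  rw [e1, e2, one_mul]

lemma aux_csumm {c : ℕ → ℝ} (hc : ∀ k, 0 ≤ c k)
    (hrad : ∃ R : ℝ, 1 < R ∧ Summable fun k => c k * R ^ k) : Summable c := by
  obtain ⟨R, hR, h⟩ := hrad
  exact Summable.of_nonneg_of_le hc
    (fun k => le_mul_of_one_le_right (hc k) (one_le_pow₀ hR.le)) h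

lemma aux_Acont {c : ℕ → ℝ} (hc : ∀ k, 0 ≤ c k) (hs : Summable c) :
    ContinuousOn (APow c) (Set.Icc 0 1) := by
  unfold APow
  refine continuousOn_tsum (fun i => by fun_prop) hs ?_
  intro n x hx
  rw [norm_mul, norm_pow, Real.norm_of_nonneg (hc n), Real.norm_of_nonneg hx.1]
  exact mul_le_of_le_one_right (hc n) (pow_le_one₀ hx.1 hx.2)

lemma aux_hasSum {c : ℕ → ℝ} (hc : ∀ k, 0 ≤ c k) (hs : Summable c)
    {q y u : ℝ} (h0 : 0 < q) (h1 : q < 1) (hy : 0 ≤ y) (hy1 : (1 - q) * y < 1)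
    (hu0 : 0 ≤ u) (hu1 : u ≤ 1) :
    HasSum (fun k : ℕ => (∑ j ∈ Finset.range (k + 1), c j * y ^ (k - j) / qFact q (k - j)) * u ^ k)
      (APow c u * qExp q (u * y)) := by
  have hA : Summable fun k => ‖c k * u ^ k‖ := by
    refine Summable.of_nonneg_of_le (fun _ => norm_nonneg _) (fun n => ?_) hs
    rw [norm_mul, norm_pow, Real.norm_of_nonneg (hc n), Real.norm_of_nonneg hu0]
    exact mul_le_of_le_one_right (hc n) (pow_le_one₀ hu0 hu1)
  have hE : Summable fun k : ℕ => ‖(u * y) ^ k / qFact q k‖ := by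
    refine (aux_summ (y := u * y) h0 h1 (by positivity) ?_).norm
    exact lt_of_le_of_lt (mul_le_mul_of_nonneg_left (mul_le_of_le_one_left hy hu1)
      (by linarith)) hy1
  have h := hasSum_sum_range_mul_of_summable_norm hA hE
  unfold APow qExp
  refine Eq.mp (congrArg (fun F => HasSum F _) (funext fun k => Eq.symm ?_)) h
  rw [Finset.sum_mul]
  refine Finset.sum_congr rfl fun j hj => ?_
  have : j ≤ k := by simpa [Nat.lt_succ_iff] using hj
  conv_lhs => rw [← Nat.add_sub_cancel' this, pow_add u]
  rw [Nat.add_sub_cancel' this, mul_pow]; ring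

lemma aux_Tq {c : ℕ → ℝ} (hc : ∀ k, 0 ≤ c k) (hs : Summable c) (hA1 : 0 < APow c 1)
    {q : ℝ} (h0 : 0 < q) (h1 : q < 1) {n : ℕ} {t α β : ℝ} (ht : 0 ≤ t) (hβ : 0 ≤ β)
    (hn : n ≠ 0) (hz : (1 - q ^ n) * t < 1) (x : ℝ) :
    Tq c q n t α β (fun s => s ^ 2) x =
      (x + (1 + (1 - q) * α) / ((1 - q ^ n) + (1 - q) * β)) ^ 2
      - 2 * (x + (1 + (1 - q) * α) / ((1 - q ^ n) + (1 - q) * β))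
          / ((1 - q ^ n) + (1 - q) * β) * (APow c q / APow c 1 * (1 - (1 - q ^ n) * t))
      + (APow c (q ^ 2) / APow c 1 * ((1 - (1 - q ^ n) * t) * (1 - q * ((1 - q ^ n) * t))))
        / ((1 - q ^ n) + (1 - q) * β) ^ 2 := by
  have hr : 0 < 1 - q ^ n := by linarith [pow_lt_one₀ h0.le h1 hn]
  have hw : 0 < 1 - q := by linarith
  set d := (1 - q ^ n) + (1 - q) * β with hd
  have hd0 : 0 < d := by positivity
  set X := x + (1 + (1 - q) * α) / d with hX
  set y := qInt q n * t with hy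
  have hyz : (1 - q) * y = (1 - q ^ n) * t := by rw [hy, ← mul_assoc, aux_qInt_mul h1]
  have hy0 : 0 ≤ y := mul_nonneg (div_nonneg hr.le hw.le) ht
  have hy1 : (1 - q) * y < 1 := by rw [hyz]; exact hz
  have H0 := aux_hasSum hc hs h0 h1 hy0 hy1 zero_le_one le_rfl
  have H1 := aux_hasSum hc hs h0 h1 hy0 hy1 h0.le h1.le
  have H2 := aux_hasSum hc hs h0 h1 hy0 hy1 (u := q ^ 2) (by positivity) (pow_le_one₀ h0.le h1.le)
  have H := ((H0.mul_left (X ^ 2)).sub (H1.mul_left (2 * X / d))).add (H2.mul_left (1 / d ^ 2))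
  have e1 := aux_exp_q h0 h1 hy0 hy1
  have e2 := aux_exp_q h0 h1 (y := q * y) (by positivity) (by nlinarith [mul_nonneg hw.le hy0])
  rw [show q * (q * y) = q ^ 2 * y by ring, e1] at e2
  have hI := aux_inv h0 h1 hy0 hy1
  have hT : ∑' k : ℕ, qAppell c q y k / qFact q k *
      (x + (qInt q k + α) / (qInt q n + β)) ^ 2 =
      X ^ 2 * (APow c 1 * qExp q (1 * y)) - 2 * X / d * (APow c q * qExp q (q * y)) +
      1 / d ^ 2 * (APow c (q ^ 2) * qExp q (q ^ 2 * y)) := by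
    refine Eq.trans (tsum_congr fun k => ?_) H.tsum_eq
    have e3 : (x + (qInt q k + α) / (qInt q n + β)) = X - q ^ k / d := by
      have : (qInt q k + α) / (qInt q n + β) = ((1 - q ^ k) + (1 - q) * α) / d := by
        rw [hd, ← aux_qInt_mul h1, ← aux_qInt_mul h1, ← mul_add, ← mul_add,
          mul_div_mul_left _ _ hw.ne']
      rw [this, hX]; ring
    rw [e3]
    unfold qAppell
    rw [mul_div_cancel_left₀ _ (aux_qFact_pos h0 h1 k).ne']
    rw [← pow_mul, mul_comm 2 k, pow_mul, one_pow]
    generalize (∑ j ∈ Finset.range (k + 1), c j * y ^ (k - j) / qFact q (k - j)) = S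
    ring
  unfold Tq
  simp only
  rw [← hy, hT, e1, e2, one_mul, ← hyz]
  have hA := hA1.ne'
  have hd' := hd0.ne'
  have hI' : qExpE q (-y) / APow c 1 = 1 / (APow c 1 * qExp q y) := by
    have : qExp q y ≠ 0 := right_ne_zero_of_mul_eq_one hI
    field_simp
    exact hI
  have hne : qExp q y ≠ 0 := right_ne_zero_of_mul_eq_one hI
  rw [hI']
  field_simp

/-- the limit functional -/
noncomputable def auxG (α β : ℝ) (p : (ℝ × ℝ) × (ℝ × ℝ)) (v : ℝ × ℝ) : ℝ :=
      (v.1 + (1 + (1 - p.1.1) * α) / ((1 - p.1.2) + (1 - p.1.1) * β)) ^ 2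
      - 2 * (v.1 + (1 + (1 - p.1.1) * α) / ((1 - p.1.2) + (1 - p.1.1) * β))
          / ((1 - p.1.2) + (1 - p.1.1) * β) * (p.2.1 * (1 - (1 - p.1.2) * v.2))
      + (p.2.2 * ((1 - (1 - p.1.2) * v.2) * (1 - p.1.1 * ((1 - p.1.2) * v.2))))
        / ((1 - p.1.2) + (1 - p.1.1) * β) ^ 2

lemma aux_unif (α β a b : ℝ) (hb : b < 1) {ε : ℝ} (hε : 0 < ε) :
    ∀ᶠ p in nhds (((1 : ℝ), b), ((1 : ℝ), (1 : ℝ))), ∀ v ∈ Set.Icc (0 : ℝ) a ×ˢ Set.Icc (0 : ℝ) a,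
      |auxG α β p v - (v.1 + v.2) ^ 2| < ε := by
  refine (isCompact_Icc.prod isCompact_Icc).eventually_forall_of_forall_eventually ?_
  intro v _
  have hb' : 1 - b ≠ 0 := by linarith
  have hv : auxG α β ((1, b), (1, 1)) v - (v.1 + v.2) ^ 2 = 0 := by
    simp only [auxG]
    simp only [sub_self, zero_mul, add_zero]
    field_simp
    ring
  have hcont : ContinuousAt (fun z : ((ℝ × ℝ) × (ℝ × ℝ)) × (ℝ × ℝ) =>
      |auxG α β z.1 z.2 - (z.2.1 + z.2.2) ^ 2|) (((1, b), (1, 1)), v) := by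
    unfold auxG
    have : (1 - b) + (1 - 1) * β ≠ 0 := by simpa using hb'
    fun_prop (disch := first | exact this | exact pow_ne_zero _ this)
  have := hcont.eventually_lt_const (u := ε) (by simp only [hv, abs_zero]; exact hε)
  exact this

lemma aux_stat {x y z : ℕ → ℝ} {l m k : ℝ} (hx : StatLim x l) (hy : StatLim y m)
    (h : ∀ ε > 0, ∃ δ > 0, ∀ n, 1 ≤ n → |x n - l| < δ → |y n - m| < δ → |z n - k| < ε) :
    StatLim z k := by
  intro ε hε
  obtain ⟨δ, hδ, H⟩ := h ε hε
  have h3 := (hx δ hδ).add (hy δ hδ)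
  rw [add_zero] at h3
  refine squeeze_zero (fun n => by positivity) (fun n => ?_) h3
  rw [← add_div]
  gcongr
  norm_cast
  refine le_trans (Finset.card_le_card ?_) (Finset.card_union_le _ _)
  intro i hi
  simp only [Finset.mem_union, Finset.mem_filter] at hi ⊢
  by_contra hcon
  push Not at hcon
  have hi1 := Finset.mem_Icc.1 hi.1
  exact absurd (H i hi1.1 (hcon.1 hi.1) (hcon.2 hi.1)) (not_lt.2 hi.2)

/-- `st-lim_n sup_{x,t ∈ [0,a]} |T_{n,t}^{α,β}(e₂;qₙ;x) − (x+t)²| = 0`. -/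
theorem stmt_8 (c : ℕ → ℝ) (hc : ∀ k, 0 ≤ c k)
    (hrad : ∃ R : ℝ, 1 < R ∧ Summable fun k => c k * R ^ k) (hA1 : 0 < APow c 1)
    (α β : ℝ) (hα : 0 ≤ α) (hβ : 0 ≤ β) (a : ℝ) (ha : 0 < a)
    (qs : ℕ → ℝ) (hqs : ∀ n, 0 < qs n ∧ qs n < 1)
    (hqa : ∀ n, (1 - qs n ^ n) * a < 1)
    (hst1 : StatLim qs 1) (b : ℝ) (hb : b < 1)
    (hst2 : StatLim (fun n => qs n ^ n) b) :
    StatLim (fun n => sSup {r : ℝ | ∃ x t : ℝ, x ∈ Set.Icc 0 a ∧ t ∈ Set.Icc 0 a ∧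
      r = |Tq c (qs n) n t α β (fun s => s ^ 2) x - (x + t) ^ 2|}) 0 := by
  have hs := aux_csumm hc hrad
  refine aux_stat hst1 hst2 fun ε hε => ?_
  have hU := aux_unif α β a b hb (half_pos hε)
  have hA := aux_Acont hc hs
  have hL : Tendsto (fun p : ℝ × ℝ => ((p.1, p.2), (APow c p.1 / APow c 1,
      APow c (p.1 ^ 2) / APow c 1))) (nhdsWithin (1, b) {p | p.1 ∈ Set.Icc (0 : ℝ) 1})
      (nhds ((1, b), (1, 1))) := by
    have h1 : Tendsto (fun p : ℝ × ℝ => p.1) (nhdsWithin (1, b) {p | p.1 ∈ Set.Icc (0 : ℝ) 1})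
        (nhdsWithin 1 (Set.Icc 0 1)) :=
      tendsto_nhdsWithin_iff.2 ⟨(continuous_fst.tendsto (1, b)).mono_left nhdsWithin_le_nhds,
        eventually_mem_nhdsWithin⟩
    have h2 : Tendsto (fun p : ℝ × ℝ => p.1 ^ 2)
        (nhdsWithin (1, b) {p | p.1 ∈ Set.Icc (0 : ℝ) 1}) (nhdsWithin 1 (Set.Icc 0 1)) := by
      refine tendsto_nhdsWithin_iff.2 ⟨?_, ?_⟩
      · have : Continuous fun p : ℝ × ℝ => p.1 ^ 2 := by fun_prop
        simpa using (this.tendsto (1, b)).mono_left nhdsWithin_le_nhds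
      · filter_upwards [eventually_mem_nhdsWithin] with p hp
        exact ⟨by positivity, pow_le_one₀ hp.1 hp.2⟩
    have hA' : Tendsto (fun u => APow c u / APow c 1) (nhdsWithin 1 (Set.Icc 0 1)) (nhds 1) := by
      have := (hA 1 ⟨zero_le_one, le_rfl⟩).tendsto.div_const (APow c 1)
      rwa [div_self hA1.ne'] at this
    refine Tendsto.prodMk_nhds ?_ ((hA'.comp h1).prodMk_nhds (hA'.comp h2))
    exact tendsto_id.mono_left nhdsWithin_le_nhds
  have hE := hL.eventually hU
  obtain ⟨δ, hδ, hball⟩ := Metric.mem_nhdsWithin_iff.1 hE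
  refine ⟨δ, hδ, fun n hn h1 h2 => ?_⟩
  obtain ⟨hq0, hq1⟩ := hqs n
  have hmem : ((qs n, qs n ^ n) : ℝ × ℝ) ∈
      Metric.ball ((1 : ℝ), b) δ ∩ {p | p.1 ∈ Set.Icc (0 : ℝ) 1} := by
    refine ⟨?_, hq0.le, hq1.le⟩
    rw [Metric.mem_ball, Prod.dist_eq, Real.dist_eq, Real.dist_eq]
    exact max_lt h1 h2
  have hv := hball hmem
  have hr : 0 ≤ 1 - qs n ^ n := by linarith [pow_le_one₀ (n := n) hq0.le hq1.le]
  have hle : ∀ r ∈ {r : ℝ | ∃ x t : ℝ, x ∈ Set.Icc 0 a ∧ t ∈ Set.Icc 0 a ∧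
      r = |Tq c (qs n) n t α β (fun s => s ^ 2) x - (x + t) ^ 2|}, r ≤ ε / 2 := by
    rintro r ⟨x, t, hx, ht, rfl⟩
    rw [aux_Tq hc hs hA1 hq0 hq1 ht.1 hβ (by omega)
      (lt_of_le_of_lt (mul_le_mul_of_nonneg_left ht.2 hr) (hqa n))]
    exact (hv (x, t) ⟨hx, ht⟩).le
  rw [sub_zero, abs_of_nonneg]
  · exact lt_of_le_of_lt (Real.sSup_le hle (by linarith)) (by linarith)
  · refine Real.sSup_nonneg ?_
    rintro r ⟨x, t, hx, ht, rfl⟩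
    exact abs_nonneg _
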